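/- arXiv:1903.02143 — 2 statements merged into one kernel-verified Lean document; each statement's English description precedes it below -/
import Mathlib

section
/- (Minkowski-plane case of the paper's Appendix Lemma on upper semicontinuity of the length functional.) Let γ_i : [0,1] → ℝ² be a sequence of Lipschitz curves, each almost everywhere future-directed causal, converging uniformly to a Lipschitz curve γ : [0,1] → ℝ² that is almost everywhere future-directed causal. Then limsup_{i→∞} L(γ_i) ≤ L(γ). -/
open Set Filter MeasureTheory
open scoped ENNReal

/-- The Lorentzian length of a curve in the Minkowski plane. -/
noncomputable def Llen (γ : ℝ → ℝ × ℝ) : ℝ :=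
  ∫ s in (0 : ℝ)..1, Real.sqrt ((deriv γ s).2 ^ 2 - (deriv γ s).1 ^ 2)

/-- A Lipschitz curve is almost everywhere future-directed causal on `[0,1]`. -/
def AECausal (σ : ℝ → ℝ × ℝ) : Prop :=
  ∀ᵐ s ∂(volume.restrict (Set.Icc (0 : ℝ) 1)), |(deriv σ s).1| ≤ (deriv σ s).2

open scoped Topology NNReal

/-- The Lorentzian norm of a vector of the Minkowski plane, zero on spacelike vectors. -/
noncomputable def lorentzNorm (v : ℝ × ℝ) : ℝ := Real.sqrt (v.2 ^ 2 - v.1 ^ 2)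

lemma continuous_lorentzNorm : Continuous lorentzNorm := by
  unfold lorentzNorm
  fun_prop

lemma lorentzNorm_nonneg (v : ℝ × ℝ) : 0 ≤ lorentzNorm v := Real.sqrt_nonneg _

lemma lorentzNorm_le_norm (v : ℝ × ℝ) : lorentzNorm v ≤ ‖v‖ := by
  refine Real.sqrt_le_iff.2 ⟨norm_nonneg v, ?_⟩
  have h : |v.2| ≤ ‖v‖ := norm_snd_le v
  nlinarith [sq_abs v.2, sq_nonneg v.1, abs_nonneg v.2]

lemma lorentzNorm_smul {c : ℝ} (hc : 0 ≤ c) (v : ℝ × ℝ) :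
    lorentzNorm (c • v) = c * lorentzNorm v := by
  have h : (c • v).2 ^ 2 - (c • v).1 ^ 2 = c ^ 2 * (v.2 ^ 2 - v.1 ^ 2) := by
    simp only [Prod.smul_fst, Prod.smul_snd, smul_eq_mul]
    ring
  rw [lorentzNorm, h, Real.sqrt_mul (sq_nonneg c), Real.sqrt_sq hc, lorentzNorm]

/-- The reversed arithmetic-geometric inequality in null coordinates. -/
lemma quadratic_nonneg_of_causal {v : ℝ × ℝ} (hv : |v.1| ≤ v.2) (t : ℝ) :
    0 ≤ t * t * (v.2 + v.1) + t * (-2 * lorentzNorm v) + (v.2 - v.1) := by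
  obtain ⟨h₁, h₂⟩ := abs_le.1 hv
  have hp : 0 ≤ v.2 + v.1 := by linarith
  have hq : 0 ≤ v.2 - v.1 := by linarith
  have hN : lorentzNorm v = Real.sqrt (v.2 + v.1) * Real.sqrt (v.2 - v.1) := by
    rw [← Real.sqrt_mul hp, lorentzNorm]
    ring_nf
  rw [hN]
  nlinarith [sq_nonneg (t * Real.sqrt (v.2 + v.1) - Real.sqrt (v.2 - v.1)),
    Real.sq_sqrt hp, Real.sq_sqrt hq]

lemma LipschitzOnWith.ae_differentiableAt_unitInterval {σ : ℝ → ℝ × ℝ} {K : ℝ≥0}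
    (h : LipschitzOnWith K σ (Icc 0 1)) :
    ∀ᵐ s : ℝ, s ∈ Ioo (0 : ℝ) 1 → DifferentiableAt ℝ σ s := by
  filter_upwards [h.ae_differentiableWithinAt_of_mem (μ := volume)] with s hs hmem
  exact (hs (Ioo_subset_Icc_self hmem)).differentiableAt (Icc_mem_nhds hmem.1 hmem.2)

lemma ae_mem_Ioo_of_mem_Ioc (a b : ℝ) : ∀ᵐ s : ℝ, s ∈ Ioc a b → s ∈ Ioo a b := by
  have h : ∀ᵐ s : ℝ, s ≠ b := by simp [ae_iff, measure_singleton]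
  filter_upwards [h] with s hs hmem
  exact ⟨hmem.1, lt_of_le_of_ne hmem.2 hs⟩

/-- The fundamental theorem of calculus for a Lipschitz function on a subinterval of `[0,1]`. -/
lemma LipschitzOnWith.intervalIntegrable_deriv_and_integral {f : ℝ → ℝ} {K : ℝ≥0}
    (h : LipschitzOnWith K f (Icc 0 1)) {a b : ℝ} (ha : 0 ≤ a) (hab : a ≤ b) (hb : b ≤ 1) :
    IntervalIntegrable (deriv f) volume a b ∧ ∫ s in a..b, deriv f s = f b - f a := by
  have hac : AbsolutelyContinuousOnInterval f a b := by
    refine LipschitzOnWith.absolutelyContinuousOnInterval (K := K) (h.mono ?_)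
    rw [uIcc_of_le hab]
    exact Icc_subset_Icc ha hb
  exact ⟨hac.intervalIntegrable_deriv, hac.integral_deriv_eq_sub⟩

lemma integral_deriv_components {σ : ℝ → ℝ × ℝ} {K : ℝ≥0}
    (h : LipschitzOnWith K σ (Icc 0 1)) {a b : ℝ} (ha : 0 ≤ a) (hab : a ≤ b) (hb : b ≤ 1) :
    (IntervalIntegrable (fun s ↦ (deriv σ s).1) volume a b ∧
      ∫ s in a..b, (deriv σ s).1 = (σ b - σ a).1) ∧
    (IntervalIntegrable (fun s ↦ (deriv σ s).2) volume a b ∧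
      ∫ s in a..b, (deriv σ s).2 = (σ b - σ a).2) := by
  have hae : ∀ᵐ s : ℝ, s ∈ uIoc a b → DifferentiableAt ℝ σ s := by
    filter_upwards [h.ae_differentiableAt_unitInterval, ae_mem_Ioo_of_mem_Ioc a b] with s h₁ h₂ hs
    rw [uIoc_of_le hab] at hs
    exact h₁ ⟨ha.trans_lt (h₂ hs).1, (h₂ hs).2.trans_le hb⟩
  have h₁ : ∀ᵐ s : ℝ, s ∈ uIoc a b → deriv (fun r ↦ (σ r).1) s = (deriv σ s).1 := by
    filter_upwards [hae] with s hs hmem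
    simpa using ((hs hmem).hasFDerivAt.fst.hasDerivAt).deriv
  have h₂ : ∀ᵐ s : ℝ, s ∈ uIoc a b → deriv (fun r ↦ (σ r).2) s = (deriv σ s).2 := by
    filter_upwards [hae] with s hs hmem
    simpa using ((hs hmem).hasFDerivAt.snd.hasDerivAt).deriv
  obtain ⟨i₁, e₁⟩ := (LipschitzWith.prod_fst.comp_lipschitzOnWith
    h).intervalIntegrable_deriv_and_integral ha hab hb
  obtain ⟨i₂, e₂⟩ := (LipschitzWith.prod_snd.comp_lipschitzOnWith
    h).intervalIntegrable_deriv_and_integral ha hab hb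
  refine ⟨⟨i₁.congr_ae ((ae_restrict_iff' measurableSet_uIoc).2 h₁), ?_⟩,
    ⟨i₂.congr_ae ((ae_restrict_iff' measurableSet_uIoc).2 h₂), ?_⟩⟩
  · rw [← intervalIntegral.integral_congr_ae h₁]
    exact e₁
  · rw [← intervalIntegral.integral_congr_ae h₂]
    exact e₂

/-- The reversed triangle inequality: a chord of a causal curve is at least as long as the
corresponding arc. -/
lemma integral_lorentzNorm_deriv_le {σ : ℝ → ℝ × ℝ} {K : ℝ≥0}
    (h : LipschitzOnWith K σ (Icc 0 1)) (hc : AECausal σ)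
    {a b : ℝ} (ha : 0 ≤ a) (hab : a ≤ b) (hb : b ≤ 1) :
    IntervalIntegrable (fun s ↦ lorentzNorm (deriv σ s)) volume a b ∧
      ∫ s in a..b, lorentzNorm (deriv σ s) ≤ lorentzNorm (σ b - σ a) := by
  obtain ⟨⟨i₁, e₁⟩, ⟨i₂, e₂⟩⟩ := integral_deriv_components h ha hab hb
  have hcaus : ∀ᵐ s ∂(volume.restrict (Icc a b)), |(deriv σ s).1| ≤ (deriv σ s).2 :=
    ae_restrict_of_ae_restrict_of_subset (Icc_subset_Icc ha hb) hc
  have hint : IntervalIntegrable (fun s ↦ lorentzNorm (deriv σ s)) volume a b := by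
    refine i₂.mono_fun
      (continuous_lorentzNorm.measurable.comp (measurable_deriv σ)).aestronglyMeasurable ?_
    refine Eventually.of_forall fun s ↦ ?_
    change ‖lorentzNorm (deriv σ s)‖ ≤ ‖(deriv σ s).2‖
    rw [Real.norm_of_nonneg (lorentzNorm_nonneg _), Real.norm_eq_abs, ← Real.sqrt_sq_eq_abs]
    exact Real.sqrt_le_sqrt (by nlinarith [sq_nonneg (deriv σ s).1])
  refine ⟨hint, ?_⟩
  set L := ∫ s in a..b, lorentzNorm (deriv σ s) with hL
  have hquad : ∀ t : ℝ, 0 ≤ ((σ b - σ a).2 + (σ b - σ a).1) * (t * t) + (-2 * L) * t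
      + ((σ b - σ a).2 - (σ b - σ a).1) := by
    intro t
    have hnn : 0 ≤ ∫ s in a..b, (t * t * ((deriv σ s).2 + (deriv σ s).1)
        + t * (-2 * lorentzNorm (deriv σ s)) + ((deriv σ s).2 - (deriv σ s).1)) := by
      refine intervalIntegral.integral_nonneg_of_ae_restrict hab ?_
      filter_upwards [hcaus] with s hs
      exact quadratic_nonneg_of_causal hs t
    rw [intervalIntegral.integral_add (((i₂.add i₁).const_mul _).add
        ((hint.const_mul _).const_mul _)) (i₂.sub i₁),
      intervalIntegral.integral_add ((i₂.add i₁).const_mul _) ((hint.const_mul _).const_mul _),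
      intervalIntegral.integral_const_mul, intervalIntegral.integral_const_mul,
      intervalIntegral.integral_const_mul, intervalIntegral.integral_add i₂ i₁,
      intervalIntegral.integral_sub i₂ i₁, e₁, e₂, ← hL] at hnn
    linarith
  have hdisc := discrim_le_zero hquad
  refine Real.le_sqrt_of_sq_le ?_
  rw [discrim] at hdisc
  nlinarith

/-- The Lorentzian length of the polygon inscribed in `σ` at the multiples of `1 / n`. -/
noncomputable def polygonLength (n : ℕ) (σ : ℝ → ℝ × ℝ) : ℝ :=
  ∑ k ∈ Finset.range n, lorentzNorm (σ ((k + 1 : ℕ) / n) - σ (k / n))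

lemma natCast_div_mem_Icc {n k : ℕ} (hk : k ≤ n) : (k / n : ℝ) ∈ Icc (0 : ℝ) 1 :=
  ⟨by positivity, div_le_one_of_le₀ (by exact_mod_cast hk) (by positivity)⟩

lemma Llen_le_polygonLength {σ : ℝ → ℝ × ℝ} {K : ℝ≥0} (h : LipschitzOnWith K σ (Icc 0 1))
    (hc : AECausal σ) {n : ℕ} (hn : 0 < n) : Llen σ ≤ polygonLength n σ := by
  have hstep : ∀ k < n, IntervalIntegrable (fun s ↦ lorentzNorm (deriv σ s)) volume
        ((k : ℕ) / n : ℝ) ((k + 1 : ℕ) / n : ℝ) ∧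
      ∫ s in ((k : ℕ) / n : ℝ)..((k + 1 : ℕ) / n : ℝ), lorentzNorm (deriv σ s) ≤
        lorentzNorm (σ ((k + 1 : ℕ) / n) - σ (k / n)) := fun k hk ↦
    integral_lorentzNorm_deriv_le h hc (natCast_div_mem_Icc hk.le).1
      (by gcongr; exact Nat.le_succ k) (natCast_div_mem_Icc hk).2
  have hsum := intervalIntegral.sum_integral_adjacent_intervals
    (a := fun k : ℕ ↦ (k / n : ℝ)) fun k hk ↦ (hstep k hk).1
  have hn' : (n : ℝ) ≠ 0 := by positivity
  simp only [Nat.cast_zero, zero_div, div_self hn'] at hsum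
  change ∫ s in (0 : ℝ)..1, lorentzNorm (deriv σ s) ≤ _
  rw [← hsum]
  exact Finset.sum_le_sum fun k hk ↦ (hstep k (Finset.mem_range.1 hk)).2

lemma tendsto_polygonLength {γi : ℕ → ℝ → ℝ × ℝ} {γ : ℝ → ℝ × ℝ}
    (hconv : TendstoUniformlyOn γi γ atTop (Icc 0 1)) (n : ℕ) :
    Tendsto (fun i ↦ polygonLength n (γi i)) atTop (𝓝 (polygonLength n γ)) := by
  refine tendsto_finsetSum _ fun k hk ↦ ?_
  have hk' := Finset.mem_range.1 hk
  exact (continuous_lorentzNorm.tendsto _).comp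
    ((hconv.tendsto_at (natCast_div_mem_Icc hk')).sub
      (hconv.tendsto_at (natCast_div_mem_Icc hk'.le)))

/-- The Lorentzian norm of the difference quotient of `σ` over the interval
`[k / n, (k + 1) / n)` containing `s`. -/
noncomputable def stepSpeed (σ : ℝ → ℝ × ℝ) (n : ℕ) (s : ℝ) : ℝ :=
  n * lorentzNorm (σ ((⌊n * s⌋₊ + 1 : ℕ) / n) - σ (⌊n * s⌋₊ / n))

lemma measurable_stepSpeed (σ : ℝ → ℝ × ℝ) (n : ℕ) : Measurable (stepSpeed σ n) := by
  have h : Measurable fun k : ℕ ↦ n * lorentzNorm (σ ((k + 1 : ℕ) / n) - σ (k / n)) :=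
    measurable_of_countable _
  exact h.comp (Nat.measurable_floor.comp (measurable_const_mul _))

lemma floor_add_one_le {n : ℕ} {s : ℝ} (hn : 0 < n) (hs : s ∈ Ioo (0 : ℝ) 1) :
    ⌊n * s⌋₊ + 1 ≤ n := by
  have hn' : (0 : ℝ) < n := by positivity
  exact Nat.succ_le_of_lt ((Nat.floor_lt (by have := hs.1; positivity)).2 (by nlinarith [hs.2]))

lemma stepSpeed_le {σ : ℝ → ℝ × ℝ} {K : ℝ≥0} (h : LipschitzOnWith K σ (Icc 0 1))
    {n : ℕ} (hn : 0 < n) {s : ℝ} (hs : s ∈ Ioo (0 : ℝ) 1) : ‖stepSpeed σ n s‖ ≤ K := by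
  have hn' : (0 : ℝ) < n := by positivity
  have hk := floor_add_one_le hn hs
  rw [stepSpeed, Real.norm_of_nonneg (mul_nonneg hn'.le (lorentzNorm_nonneg _))]
  set k := ⌊n * s⌋₊
  have hd := h.norm_sub_le (natCast_div_mem_Icc hk) (natCast_div_mem_Icc (Nat.le_of_succ_le hk))
  have he : ((k + 1 : ℕ) / n - k / n : ℝ) = 1 / n := by push_cast; ring
  rw [he, Real.norm_of_nonneg (by positivity)] at hd
  calc _ ≤ (n : ℝ) * (K * (1 / n)) := by
        gcongr
        exact (lorentzNorm_le_norm _).trans hd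
    _ = K := by field_simp

lemma integral_stepSpeed (σ : ℝ → ℝ × ℝ) {n : ℕ} (hn : 0 < n) :
    ∫ s in (0 : ℝ)..1, stepSpeed σ n s = polygonLength n σ := by
  have hn' : (0 : ℝ) < n := by positivity
  have heq : ∀ k : ℕ, EqOn (stepSpeed σ n)
      (fun _ ↦ n * lorentzNorm (σ ((k + 1 : ℕ) / n) - σ (k / n)))
      (Ioo (k / n : ℝ) ((k + 1 : ℕ) / n : ℝ)) := by
    intro k s hs
    have hfl : ⌊n * s⌋₊ = k := by
      have h₁ := (div_lt_iff₀' hn').1 hs.1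
      have h₂ := (lt_div_iff₀' hn').1 hs.2
      push_cast at h₂
      exact (Nat.floor_eq_iff ((Nat.cast_nonneg k).trans h₁.le)).2 ⟨h₁.le, h₂⟩
    simp only [stepSpeed, hfl]
  have hle : ∀ k : ℕ, (k / n : ℝ) ≤ ((k + 1 : ℕ) / n : ℝ) := fun k ↦ by
    gcongr
    exact Nat.le_succ k
  have hsum := intervalIntegral.sum_integral_adjacent_intervals (f := stepSpeed σ n)
    (μ := volume) (a := fun k : ℕ ↦ (k / n : ℝ)) (n := n) fun k _ ↦ by
      refine (intervalIntegrable_const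
        (c := n * lorentzNorm (σ ((k + 1 : ℕ) / n) - σ (k / n)))).congr_ae ?_
      refine (ae_restrict_iff' measurableSet_uIoc).2 ?_
      filter_upwards [ae_mem_Ioo_of_mem_Ioc (k / n : ℝ) ((k + 1 : ℕ) / n : ℝ)] with s hs hmem
      rw [uIoc_of_le (hle k)] at hmem
      exact (heq k (hs hmem)).symm
  simp only [Nat.cast_zero, zero_div, div_self hn'.ne'] at hsum
  rw [← hsum, polygonLength]
  refine Finset.sum_congr rfl fun k _ ↦ ?_
  rw [intervalIntegral.integral_congr_Ioo_of_le (hle k) (heq k),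
    intervalIntegral.integral_const, smul_eq_mul]
  have he : ((k + 1 : ℕ) / n - k / n : ℝ) = 1 / n := by push_cast; ring
  rw [he]
  field_simp

/-- Difference quotients over shrinking intervals containing a point of differentiability converge
to the derivative. -/
lemma HasDerivAt.tendsto_natCast_smul_sub {E : Type*} [NormedAddCommGroup E] [NormedSpace ℝ E]
    {σ : ℝ → E} {v : E} {s : ℝ} (h : HasDerivAt σ v s) (hs : 0 ≤ s) :
    Tendsto (fun n : ℕ ↦ (n : ℝ) • (σ ((⌊n * s⌋₊ + 1 : ℕ) / n) - σ (⌊n * s⌋₊ / n)))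
      atTop (𝓝 v) := by
  have key : ∀ c : ℕ → ℝ, (∀ᶠ n : ℕ in atTop, |c n - s| ≤ 1 / n) →
      Tendsto (fun n : ℕ ↦ (n : ℝ) • (σ (c n) - σ s - (c n - s) • v)) atTop (𝓝 0) := by
    intro c hc
    have hinv : Tendsto (fun n : ℕ ↦ (1 / n : ℝ)) atTop (𝓝 0) := tendsto_one_div_atTop_nhds_zero_nat
    have hcs : Tendsto c atTop (𝓝 s) := by
      rw [tendsto_iff_dist_tendsto_zero]
      exact squeeze_zero' (Eventually.of_forall fun _ ↦ dist_nonneg) hc hinv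
    have hO : (fun n ↦ c n - s) =O[atTop] fun n : ℕ ↦ (1 / n : ℝ) := by
      refine Asymptotics.IsBigO.of_bound 1 ?_
      filter_upwards [hc] with n hn
      rw [one_mul, Real.norm_eq_abs, Real.norm_of_nonneg (by positivity)]
      exact hn
    have ho := (h.isLittleO.comp_tendsto hcs).trans_isBigO hO
    have hs' := (Asymptotics.isBigO_refl (fun n : ℕ ↦ (n : ℝ)) atTop).smul_isLittleO ho
    refine (hs'.trans_isBigO ?_ : _ =o[atTop] fun _ ↦ (1 : ℝ)).tendsto_zero_of_tendsto
      tendsto_const_nhds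
    refine Asymptotics.IsBigO.of_bound 1 ?_
    filter_upwards [eventually_gt_atTop 0] with n hn
    have hn' : (n : ℝ) ≠ 0 := by positivity
    simp [hn']
  have hfl : ∀ᶠ n : ℕ in atTop, 0 < (n : ℝ) ∧ (⌊n * s⌋₊ : ℝ) ≤ n * s ∧ n * s < ⌊n * s⌋₊ + 1 := by
    filter_upwards [eventually_gt_atTop 0] with n hn
    exact ⟨by positivity, Nat.floor_le (by positivity), Nat.lt_floor_add_one _⟩
  have h₁ := key (fun n ↦ (⌊n * s⌋₊ + 1 : ℕ) / n) <| by
    filter_upwards [hfl] with n ⟨hn, hl, hu⟩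
    have e : ((⌊n * s⌋₊ + 1 : ℕ) / n - s : ℝ) = (⌊n * s⌋₊ + 1 - n * s) / n := by
      push_cast
      field_simp
    rw [e, abs_div, abs_of_pos hn]
    gcongr
    rw [abs_le]
    constructor <;> linarith
  have h₂ := key (fun n ↦ ⌊n * s⌋₊ / n) <| by
    filter_upwards [hfl] with n ⟨hn, hl, hu⟩
    have e : (⌊n * s⌋₊ / n - s : ℝ) = (⌊n * s⌋₊ - n * s) / n := by
      field_simp
    rw [e, abs_div, abs_of_pos hn]
    gcongr
    rw [abs_le]
    constructor <;> linarith
  have h₃ := (h₁.sub h₂).add_const v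
  rw [sub_zero, zero_add] at h₃
  refine h₃.congr' ?_
  filter_upwards [eventually_gt_atTop 0] with n hn
  have hn' : (n : ℝ) ≠ 0 := by positivity
  rw [← smul_sub]
  have e : σ ((⌊n * s⌋₊ + 1 : ℕ) / n) - σ s - (((⌊n * s⌋₊ + 1 : ℕ) / n : ℝ) - s) • v
      - (σ (⌊n * s⌋₊ / n) - σ s - ((⌊n * s⌋₊ / n : ℝ) - s) • v)
      = σ ((⌊n * s⌋₊ + 1 : ℕ) / n) - σ (⌊n * s⌋₊ / n) - (1 / n : ℝ) • v := by
    have e' : (1 / n : ℝ) = (((⌊n * s⌋₊ + 1 : ℕ) / n : ℝ) - s) - ((⌊n * s⌋₊ / n : ℝ) - s) := by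
      push_cast
      ring
    rw [e']
    module
  rw [e, smul_sub, smul_smul, mul_one_div_cancel hn', one_smul, sub_add_cancel]

/-- The lengths of inscribed polygons converge to the Lorentzian length. -/
lemma tendsto_polygonLength_Llen {σ : ℝ → ℝ × ℝ} {K : ℝ≥0}
    (h : LipschitzOnWith K σ (Icc 0 1)) :
    Tendsto (fun n ↦ polygonLength n σ) atTop (𝓝 (Llen σ)) := by
  have hlim : Tendsto (fun n ↦ ∫ s in (0 : ℝ)..1, stepSpeed σ n s) atTop
      (𝓝 (∫ s in (0 : ℝ)..1, lorentzNorm (deriv σ s))) := by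
    refine intervalIntegral.tendsto_integral_filter_of_dominated_convergence (fun _ ↦ (K : ℝ))
      (Eventually.of_forall fun n ↦ (measurable_stepSpeed σ n).aestronglyMeasurable) ?_
      intervalIntegrable_const ?_
    · filter_upwards [eventually_gt_atTop 0] with n hn
      filter_upwards [ae_mem_Ioo_of_mem_Ioc 0 1] with s hs hmem
      rw [uIoc_of_le zero_le_one] at hmem
      exact stepSpeed_le h hn (hs hmem)
    · filter_upwards [ae_mem_Ioo_of_mem_Ioc 0 1, h.ae_differentiableAt_unitInterval]
        with s hs hd hmem
      rw [uIoc_of_le zero_le_one] at hmem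
      have ht := (continuous_lorentzNorm.tendsto _).comp
        ((hd (hs hmem)).hasDerivAt.tendsto_natCast_smul_sub hmem.1.le)
      refine ht.congr fun n ↦ ?_
      exact lorentzNorm_smul (Nat.cast_nonneg n) _
  refine hlim.congr' ?_
  filter_upwards [eventually_gt_atTop 0] with n hn
  exact integral_stepSpeed σ hn

/-- Upper semicontinuity of the Lorentzian length functional in the Minkowski plane:
if almost everywhere future-directed causal Lipschitz curves `γᵢ` converge uniformly to
such a curve `γ`, then `limsup L(γᵢ) ≤ L(γ)`. -/
theorem stmt_14 (γi : ℕ → ℝ → ℝ × ℝ) (γ : ℝ → ℝ × ℝ)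
    (Ki : ℕ → NNReal) (K : NNReal)
    (hlipi : ∀ i, LipschitzOnWith (Ki i) (γi i) (Set.Icc 0 1))
    (hlip : LipschitzOnWith K γ (Set.Icc 0 1))
    (hci : ∀ i, AECausal (γi i)) (hc : AECausal γ)
    (hconv : TendstoUniformlyOn γi γ atTop (Set.Icc 0 1)) :
    Filter.limsup (fun i => ENNReal.ofReal (Llen (γi i))) atTop ≤ ENNReal.ofReal (Llen γ) := by
  have hpoly : ∀ n : ℕ, 0 < n → Filter.limsup (fun i => ENNReal.ofReal (Llen (γi i))) atTop ≤
      ENNReal.ofReal (polygonLength n γ) := fun n hn ↦ by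
    rw [← (ENNReal.tendsto_ofReal (tendsto_polygonLength hconv n)).limsup_eq]
    exact limsup_le_limsup (Eventually.of_forall fun i ↦
      ENNReal.ofReal_le_ofReal (Llen_le_polygonLength (hlipi i) (hci i) hn))
  refine ge_of_tendsto (ENNReal.tendsto_ofReal (tendsto_polygonLength_Llen hlip)) ?_
  filter_upwards [eventually_gt_atTop 0] with n hn
  exact hpoly n hn
end

section
/- (Minkowski-plane case of the paper's Appendix Lemma identifying the two definitions of Lorentzian arc length.) Let γ : [0,1] → ℝ² be a Lipschitz curve that is almost everywhere future-directed causal. Then ∫₀¹ √(γ₂′(s)² − γ₁′(s)²) ds equals the infimum, over all partitions 0 = t₀ < t₁ < ⋯ < t_m = 1, of Σ_{j=0}^{m−1} √((γ₂(t_{j+1}) − γ₂(t_j))² − (γ₁(t_{j+1}) − γ₁(t_j))²). -/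
open Set Filter MeasureTheory
open scoped ENNReal

/-- Cauchy–Schwarz for `√p` and `√q`. -/
lemma integral_sqrt_mul_le_sqrt_mul_integral {p q : ℝ → ℝ} {a b : ℝ} (hab : a ≤ b)
    (hp : IntervalIntegrable p volume a b) (hq : IntervalIntegrable q volume a b)
    (hpq : IntervalIntegrable (fun s => Real.sqrt (p s * q s)) volume a b)
    (hp0 : ∀ᵐ s ∂(volume.restrict (Icc a b)), 0 ≤ p s)
    (hq0 : ∀ᵐ s ∂(volume.restrict (Icc a b)), 0 ≤ q s) :
    ∫ s in a..b, Real.sqrt (p s * q s) ≤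
      Real.sqrt ((∫ s in a..b, p s) * ∫ s in a..b, q s) := by
  apply Real.le_sqrt_of_sq_le
  have hquad : ∀ c : ℝ, 0 ≤ (∫ s in a..b, p s) * (c * c) +
      (-2 * ∫ s in a..b, Real.sqrt (p s * q s)) * c + ∫ s in a..b, q s := by
    intro c
    have hint : ∫ s in a..b, (c * c * p s + -2 * c * Real.sqrt (p s * q s) + q s) =
        (∫ s in a..b, p s) * (c * c) +
        (-2 * ∫ s in a..b, Real.sqrt (p s * q s)) * c + ∫ s in a..b, q s := by
      rw [intervalIntegral.integral_add ((hp.const_mul _).add (hpq.const_mul _)) hq,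
        intervalIntegral.integral_add (hp.const_mul _) (hpq.const_mul _),
        intervalIntegral.integral_const_mul, intervalIntegral.integral_const_mul]
      ring
    rw [← hint]
    apply intervalIntegral.integral_nonneg_of_ae_restrict hab
    filter_upwards [hp0, hq0] with s hs ht
    have h1 := Real.sq_sqrt hs
    have h2 := Real.sq_sqrt ht
    simp only [Pi.zero_apply]
    rw [Real.sqrt_mul hs]
    nlinarith [sq_nonneg (c * Real.sqrt (p s) - Real.sqrt (q s))]
  have := discrim_le_zero hquad
  rw [discrim] at this
  nlinarith

/-- Difference quotients over shrinking intervals that contain the base point converge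
to the derivative. -/
lemma HasDerivAt.tendsto_slope_of_mem_Icc {E : Type*} [NormedAddCommGroup E] [NormedSpace ℝ E]
    {f : ℝ → E} {f' : E} {x : ℝ} (h : HasDerivAt f f' x) {ι : Type*} {l : Filter ι}
    {u v : ι → ℝ} (hux : ∀ i, u i ≤ x) (hxv : ∀ i, x ≤ v i) (huv : ∀ i, u i < v i)
    (hu : Tendsto u l (nhds x)) (hv : Tendsto v l (nhds x)) :
    Tendsto (fun i => (v i - u i)⁻¹ • (f (v i) - f (u i))) l (nhds f') := by
  have ho := hasDerivAt_iff_isLittleO.1 h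
  have hou : (fun i => f (u i) - f x - (u i - x) • f') =o[l] fun i => v i - u i :=
    (ho.comp_tendsto hu).trans_isBigO (Asymptotics.IsBigO.of_bound 1 (Eventually.of_forall
      fun i => by
        simp only [Function.comp, Real.norm_eq_abs, one_mul]
        rw [abs_of_nonpos (sub_nonpos.2 (hux i)), abs_of_pos (sub_pos.2 (huv i))]
        linarith [hxv i]))
  have hov : (fun i => f (v i) - f x - (v i - x) • f') =o[l] fun i => v i - u i :=
    (ho.comp_tendsto hv).trans_isBigO (Asymptotics.IsBigO.of_bound 1 (Eventually.of_forall
      fun i => by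
        simp only [Function.comp, Real.norm_eq_abs, one_mul]
        rw [abs_of_nonneg (sub_nonneg.2 (hxv i)), abs_of_pos (sub_pos.2 (huv i))]
        linarith [hux i]))
  have hlim := (hov.sub hou).tendsto_inv_smul_nhds_zero.add_const f'
  rw [zero_add] at hlim
  refine hlim.congr fun i => ?_
  have hne : v i - u i ≠ 0 := (sub_pos.2 (huv i)).ne'
  have : f (v i) - f x - (v i - x) • f' - (f (u i) - f x - (u i - x) • f') =
      (f (v i) - f (u i)) - (v i - u i) • f' := by module
  rw [this, smul_sub, inv_smul_smul₀ hne, sub_add_cancel]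

/-- The Lorentzian length of the chord of a plane curve between two parameters. -/
noncomputable def chordLength (γ : ℝ → ℝ × ℝ) (x y : ℝ) : ℝ :=
  Real.sqrt (((γ y).2 - (γ x).2) ^ 2 - ((γ y).1 - (γ x).1) ^ 2)

lemma LipschitzOnWith.ae_hasDerivAt_deriv {γ : ℝ → ℝ × ℝ} {K : NNReal} {a b : ℝ}
    (h : LipschitzOnWith K γ (Icc a b)) :
    ∀ᵐ s ∂(volume.restrict (Icc a b)), HasDerivAt γ (deriv γ s) s := by
  rw [← Measure.restrict_congr_set Ioo_ae_eq_Icc, ae_restrict_iff' measurableSet_Ioo]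
  filter_upwards [h.ae_differentiableWithinAt_of_mem_real] with s hs hmem
  exact ((hs (Ioo_subset_Icc_self hmem)).differentiableAt
    (Icc_mem_nhds hmem.1 hmem.2)).hasDerivAt

/-- The fundamental theorem of calculus for a linear functional of a Lipschitz plane curve. -/
lemma LipschitzOnWith.integral_clm_deriv {γ : ℝ → ℝ × ℝ} {K : NNReal} {a b : ℝ} (hab : a ≤ b)
    (h : LipschitzOnWith K γ (Icc a b)) (φ : ℝ × ℝ →L[ℝ] ℝ) :
    IntervalIntegrable (fun s => φ (deriv γ s)) volume a b ∧
      ∫ s in a..b, φ (deriv γ s) = φ (γ b) - φ (γ a) := by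
  have hac : AbsolutelyContinuousOnInterval (φ ∘ γ) a b := by
    apply LipschitzOnWith.absolutelyContinuousOnInterval (K := ‖φ‖₊ * K)
    rw [uIcc_of_le hab]
    exact φ.lipschitz.comp_lipschitzOnWith h
  have hae : deriv (φ ∘ γ) =ᵐ[volume.restrict (uIoc a b)] fun s => φ (deriv γ s) := by
    rw [uIoc_of_le hab]
    filter_upwards [ae_mono (Measure.restrict_mono Ioc_subset_Icc_self le_rfl)
      h.ae_hasDerivAt_deriv] with s hs
    exact (φ.hasFDerivAt.comp_hasDerivAt s hs).deriv
  exact ⟨hac.intervalIntegrable_deriv.congr_ae hae,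
    (intervalIntegral.integral_congr_ae_restrict hae).symm.trans hac.integral_deriv_eq_sub⟩

lemma intervalIntegrable_sqrt_deriv {γ : ℝ → ℝ × ℝ} {K : NNReal} {a b : ℝ} (hab : a ≤ b)
    (h : LipschitzOnWith K γ (Icc a b)) :
    IntervalIntegrable (fun s => Real.sqrt ((deriv γ s).2 ^ 2 - (deriv γ s).1 ^ 2))
      volume a b := by
  have hm := measurable_deriv γ
  have hi := (h.integral_clm_deriv hab (ContinuousLinearMap.snd ℝ ℝ ℝ)).1.norm
  refine hi.mono_fun' (by fun_prop) (Eventually.of_forall fun s => ?_)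
  simp only [ContinuousLinearMap.coe_snd', Real.norm_eq_abs, abs_of_nonneg (Real.sqrt_nonneg _)]
  exact Real.sqrt_le_iff.2 ⟨abs_nonneg _, by
    rw [sq_abs]
    linarith [sq_nonneg (deriv γ s).1]⟩

/-- The reverse triangle inequality: a causal curve is no longer than its chord. -/
lemma integral_sqrt_deriv_le_chordLength {γ : ℝ → ℝ × ℝ} {K : NNReal} {a b : ℝ} (hab : a ≤ b)
    (h : LipschitzOnWith K γ (Icc a b))
    (hc : ∀ᵐ s ∂(volume.restrict (Icc a b)), |(deriv γ s).1| ≤ (deriv γ s).2) :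
    ∫ s in a..b, Real.sqrt ((deriv γ s).2 ^ 2 - (deriv γ s).1 ^ 2) ≤ chordLength γ a b := by
  obtain ⟨hp, hp'⟩ := h.integral_clm_deriv hab
    (ContinuousLinearMap.snd ℝ ℝ ℝ + ContinuousLinearMap.fst ℝ ℝ ℝ)
  obtain ⟨hq, hq'⟩ := h.integral_clm_deriv hab
    (ContinuousLinearMap.snd ℝ ℝ ℝ - ContinuousLinearMap.fst ℝ ℝ ℝ)
  simp only [add_apply, sub_apply, ContinuousLinearMap.coe_fst',
    ContinuousLinearMap.coe_snd'] at hp hp' hq hq'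
  have hpq := intervalIntegrable_sqrt_deriv hab h
  simp only [sq_sub_sq] at hpq ⊢
  refine (integral_sqrt_mul_le_sqrt_mul_integral hab hp hq hpq ?_ ?_).trans_eq ?_
  · filter_upwards [hc] with s hs
    linarith [(abs_le.1 hs).1]
  · filter_upwards [hc] with s hs
    linarith [(abs_le.1 hs).2]
  · rw [hp', hq', chordLength]
    congr 1
    ring

lemma chordLength_le {γ : ℝ → ℝ × ℝ} {K : NNReal} {S : Set ℝ} (h : LipschitzOnWith K γ S)
    {x y : ℝ} (hx : x ∈ S) (hy : y ∈ S) : chordLength γ x y ≤ K * |y - x| := by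
  have h1 := h.norm_sub_le hy hx
  have h2 : |(γ y).2 - (γ x).2| ≤ K * |y - x| := (norm_snd_le (γ y - γ x)).trans h1
  refine Real.sqrt_le_iff.2 ⟨by positivity, ?_⟩
  have := pow_le_pow_left₀ (abs_nonneg _) h2 2
  rw [sq_abs] at this
  linarith [sq_nonneg ((γ y).1 - (γ x).1)]

lemma mul_chordLength {c : ℝ} (hc : 0 ≤ c) (γ : ℝ → ℝ × ℝ) (x y : ℝ) :
    c * chordLength γ x y =
      Real.sqrt ((c • (γ y - γ x)).2 ^ 2 - (c • (γ y - γ x)).1 ^ 2) := by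
  rw [chordLength, ← Real.sqrt_sq hc, ← Real.sqrt_mul (sq_nonneg c), Real.sqrt_sq hc]
  congr 1
  simp only [Prod.smul_fst, Prod.smul_snd, Prod.fst_sub, Prod.snd_sub, smul_eq_mul]
  ring

/-- The speed of the polygonal curve inscribed at the multiples of `1 / N`. -/
noncomputable def polygonSpeed (γ : ℝ → ℝ × ℝ) (N : ℕ) (s : ℝ) : ℝ :=
  N * chordLength γ (⌊N * s⌋₊ / N) ((⌊N * s⌋₊ + 1) / N)

lemma measurable_polygonSpeed (γ : ℝ → ℝ × ℝ) (N : ℕ) : Measurable (polygonSpeed γ N) :=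
  (measurable_from_nat (f := fun k : ℕ => (N : ℝ) * chordLength γ (k / N) ((k + 1) / N))).comp
    (Nat.measurable_floor.comp (measurable_const_mul (N : ℝ)))

lemma integral_polygonSpeed (γ : ℝ → ℝ × ℝ) {N : ℕ} (hN : 0 < N) :
    ∫ s in (0 : ℝ)..1, polygonSpeed γ N s =
      ∑ j ∈ Finset.range N, chordLength γ (j / N) ((j + 1) / N) := by
  have hN' : (0 : ℝ) < N := Nat.cast_pos.2 hN
  have hle : ∀ j : ℕ, (j : ℝ) / N ≤ ((j + 1 : ℕ) : ℝ) / N := fun j => by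
    gcongr
    simp
  have heq : ∀ j : ℕ, EqOn (fun _ => (N : ℝ) * chordLength γ (j / N) ((j + 1) / N))
      (polygonSpeed γ N) (Ioo ((j : ℝ) / N) (((j + 1 : ℕ) : ℝ) / N)) := by
    rintro j s ⟨h1, h2⟩
    rw [div_lt_iff₀' hN'] at h1
    rw [lt_div_iff₀' hN'] at h2
    push_cast at h2
    have hfl : ⌊(N : ℝ) * s⌋₊ = j :=
      (Nat.floor_eq_iff ((Nat.cast_nonneg j).trans h1.le)).2 ⟨h1.le, h2⟩
    simp only [polygonSpeed, hfl]
  have hsum := intervalIntegral.sum_integral_adjacent_intervals (μ := volume)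
    (f := polygonSpeed γ N) (a := fun j : ℕ => (j : ℝ) / N) (n := N) fun j _ =>
      (intervalIntegrable_const
        (c := (N : ℝ) * chordLength γ (j / N) ((j + 1) / N))).congr_uIoo (by
          rw [uIoo_of_le (hle j)]
          exact heq j)
  simp only [Nat.cast_zero, zero_div, div_self hN'.ne'] at hsum
  rw [← hsum]
  refine Finset.sum_congr rfl fun j _ => ?_
  rw [← intervalIntegral.integral_congr_Ioo_of_le (hle j) (heq j), intervalIntegral.integral_const]
  push_cast
  rw [smul_eq_mul]
  field_simp
  ring

lemma tendsto_polygonSpeed {γ : ℝ → ℝ × ℝ} {s : ℝ} {v : ℝ × ℝ} (hs : 0 ≤ s)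
    (h : HasDerivAt γ v s) :
    Tendsto (fun n : ℕ => polygonSpeed γ (n + 1) s) atTop
      (nhds (Real.sqrt (v.2 ^ 2 - v.1 ^ 2))) := by
  have hpos : ∀ n : ℕ, (0 : ℝ) < ((n + 1 : ℕ) : ℝ) := fun n => by positivity
  have hfloor : Tendsto (fun n : ℕ => (⌊((n + 1 : ℕ) : ℝ) * s⌋₊ : ℝ) / ((n + 1 : ℕ) : ℝ))
      atTop (nhds s) := by
    have := (tendsto_nat_floor_mul_div_atTop hs).comp
      (tendsto_natCast_atTop_atTop.comp (tendsto_add_atTop_nat 1))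
    simpa only [Function.comp_def, mul_comm s] using this
  have hceil : Tendsto
      (fun n : ℕ => ((⌊((n + 1 : ℕ) : ℝ) * s⌋₊ : ℝ) + 1) / ((n + 1 : ℕ) : ℝ))
      atTop (nhds s) := by
    have := hfloor.add (tendsto_one_div_add_atTop_nhds_zero_nat (𝕜 := ℝ))
    simpa only [add_zero, add_div, Nat.cast_add, Nat.cast_one] using this
  have hslope := h.tendsto_slope_of_mem_Icc
    (fun n => (div_le_iff₀' (hpos n)).2 (Nat.floor_le (by positivity)))
    (fun n => (le_div_iff₀' (hpos n)).2 (Nat.lt_floor_add_one _).le)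
    (fun n => div_lt_div_of_pos_right (lt_add_one _) (hpos n)) hfloor hceil
  have hcont : Continuous fun w : ℝ × ℝ => Real.sqrt (w.2 ^ 2 - w.1 ^ 2) := by fun_prop
  refine ((hcont.tendsto v).comp hslope).congr fun n => ?_
  rw [polygonSpeed, mul_chordLength (hpos n).le]
  have hw : (((⌊((n + 1 : ℕ) : ℝ) * s⌋₊ : ℝ) + 1) / ((n + 1 : ℕ) : ℝ) -
      (⌊((n + 1 : ℕ) : ℝ) * s⌋₊ : ℝ) / ((n + 1 : ℕ) : ℝ))⁻¹ = ((n + 1 : ℕ) : ℝ) := by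
    rw [← sub_div, add_sub_cancel_left, one_div, inv_inv]
  simp only [Function.comp, hw]

lemma polygonSpeed_nonneg (γ : ℝ → ℝ × ℝ) (N : ℕ) (s : ℝ) : 0 ≤ polygonSpeed γ N s :=
  mul_nonneg (Nat.cast_nonneg N) (Real.sqrt_nonneg _)

lemma polygonSpeed_le {γ : ℝ → ℝ × ℝ} {K : NNReal} (h : LipschitzOnWith K γ (Icc 0 1))
    {N : ℕ} (hN : 0 < N) {s : ℝ} (hs : s ∈ Ico (0 : ℝ) 1) : polygonSpeed γ N s ≤ K := by
  have hN' : (0 : ℝ) < N := Nat.cast_pos.2 hN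
  have hlt : ⌊(N : ℝ) * s⌋₊ < N :=
    (Nat.floor_lt (mul_nonneg hN'.le hs.1)).2 (mul_lt_of_lt_one_right hN' hs.2)
  have hle : (⌊(N : ℝ) * s⌋₊ : ℝ) + 1 ≤ N := by exact_mod_cast hlt
  have hchord := chordLength_le h (x := ⌊(N : ℝ) * s⌋₊ / N) (y := (⌊(N : ℝ) * s⌋₊ + 1) / N)
    ⟨by positivity, (div_le_one hN').2 (by linarith)⟩
    ⟨by positivity, (div_le_one hN').2 hle⟩
  rw [← sub_div, add_sub_cancel_left, abs_of_pos (by positivity)] at hchord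
  calc polygonSpeed γ N s ≤ N * (K * (1 / N)) := mul_le_mul_of_nonneg_left hchord hN'.le
    _ = K := by field_simp

/-- The Lorentzian lengths of the inscribed uniform polygons converge to the length of the
curve. -/
lemma tendsto_sum_chordLength {γ : ℝ → ℝ × ℝ} {K : NNReal}
    (h : LipschitzOnWith K γ (Icc 0 1)) :
    Tendsto (fun n : ℕ => ∑ j ∈ Finset.range (n + 1),
      chordLength γ (j / ((n + 1 : ℕ) : ℝ)) ((j + 1) / ((n + 1 : ℕ) : ℝ)))
      atTop (nhds (Llen γ)) := by
  simp only [← integral_polygonSpeed γ (Nat.succ_pos _)]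
  refine intervalIntegral.tendsto_integral_filter_of_dominated_convergence (fun _ => (K : ℝ))
    (Eventually.of_forall fun n => (measurable_polygonSpeed γ (n + 1)).aestronglyMeasurable)
    (Eventually.of_forall fun n => ?_) intervalIntegrable_const ?_
  · filter_upwards [volume.ae_ne (1 : ℝ)] with s hne hs
    rw [uIoc_of_le zero_le_one] at hs
    rw [Real.norm_of_nonneg (polygonSpeed_nonneg γ _ s)]
    exact polygonSpeed_le h n.succ_pos ⟨hs.1.le, lt_of_le_of_ne hs.2 hne⟩
  · filter_upwards [(ae_restrict_iff' measurableSet_Icc).1 h.ae_hasDerivAt_deriv] with s hs hmem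
    rw [uIoc_of_le zero_le_one] at hmem
    exact tendsto_polygonSpeed hmem.1.le (hs (Ioc_subset_Icc_self hmem))

/-- The length of a causal curve is at most that of any inscribed polygon. -/
lemma Llen_le_sum_chordLength {γ : ℝ → ℝ × ℝ} {K : NNReal}
    (h : LipschitzOnWith K γ (Icc 0 1)) (hc : AECausal γ) {m : ℕ} {t : ℕ → ℝ}
    (h0 : t 0 = 0) (h1 : t m = 1) (ht : ∀ j < m, t j < t (j + 1)) :
    Llen γ ≤ ∑ j ∈ Finset.range m, chordLength γ (t j) (t (j + 1)) := by
  have hmono : MonotoneOn t (Icc 0 m) :=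
    monotoneOn_of_le_add_one ordConnected_Icc fun j _ _ hj => (ht j hj.2).le
  have hsub : ∀ j < m, Icc (t j) (t (j + 1)) ⊆ Icc 0 1 := fun j hj => by
    rw [← h0, ← h1]
    exact Icc_subset_Icc (hmono (by simp) ⟨by simp, hj.le⟩ (by simp))
      (hmono ⟨by simp, hj⟩ (by simp) hj)
  have hsum := intervalIntegral.sum_integral_adjacent_intervals (μ := volume) (n := m) (a := t)
    fun j hj => intervalIntegrable_sqrt_deriv (ht j hj).le (h.mono (hsub j hj))
  rw [h0, h1] at hsum
  rw [Llen, ← hsum]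
  refine Finset.sum_le_sum fun j hj => ?_
  have hj := Finset.mem_range.1 hj
  exact integral_sqrt_deriv_le_chordLength (ht j hj).le (h.mono (hsub j hj))
    (ae_mono (Measure.restrict_mono (hsub j hj) le_rfl) hc)

/-- The two definitions of Lorentzian arc length agree in the Minkowski plane:
the integral length equals the infimum over partitions of the sums of the Lorentzian
lengths of the chords. -/
theorem stmt_15 (γ : ℝ → ℝ × ℝ) (K : NNReal)
    (hlip : LipschitzOnWith K γ (Set.Icc 0 1)) (hc : AECausal γ) :
    Llen γ = sInf {S : ℝ | ∃ (m : ℕ) (t : ℕ → ℝ), 0 < m ∧ t 0 = 0 ∧ t m = 1 ∧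
      (∀ j < m, t j < t (j + 1)) ∧
      S = ∑ j ∈ Finset.range m,
        Real.sqrt (((γ (t (j + 1))).2 - (γ (t j)).2) ^ 2
          - ((γ (t (j + 1))).1 - (γ (t j)).1) ^ 2)} := by
  have hlow : Llen γ ∈ lowerBounds {S : ℝ | ∃ (m : ℕ) (t : ℕ → ℝ), 0 < m ∧ t 0 = 0 ∧ t m = 1 ∧
      (∀ j < m, t j < t (j + 1)) ∧
      S = ∑ j ∈ Finset.range m, chordLength γ (t j) (t (j + 1))} := by
    rintro S ⟨m, t, -, h0, h1, ht, rfl⟩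
    exact Llen_le_sum_chordLength hlip hc h0 h1 ht
  have hmem : ∀ n : ℕ, ∑ j ∈ Finset.range (n + 1),
      chordLength γ (j / ((n + 1 : ℕ) : ℝ)) ((j + 1) / ((n + 1 : ℕ) : ℝ)) ∈
      {S : ℝ | ∃ (m : ℕ) (t : ℕ → ℝ), 0 < m ∧ t 0 = 0 ∧ t m = 1 ∧
      (∀ j < m, t j < t (j + 1)) ∧
      S = ∑ j ∈ Finset.range m, chordLength γ (t j) (t (j + 1))} := fun n => by
    have hpos : (0 : ℝ) < ((n + 1 : ℕ) : ℝ) := by positivity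
    refine ⟨n + 1, fun j => j / ((n + 1 : ℕ) : ℝ), n.succ_pos, by simp, div_self hpos.ne',
      fun j _ => div_lt_div_of_pos_right (by simp) hpos, ?_⟩
    simp only [Nat.cast_add, Nat.cast_one]
  exact le_antisymm (le_csInf ⟨_, hmem 0⟩ hlow)
    (ge_of_tendsto' (tendsto_sum_chordLength hlip) fun n => csInf_le ⟨_, hlow⟩ (hmem n))
end
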